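/- Let 𝒢 be a finite set of groups and Ŝ a groupwise calibrated soft classifier over 𝒢 with a nice accuracy profile 𝒫 such that |Supp(𝒫_g)| ≥ 2 for all g ∈ 𝒢. Then for every value v with max_{g∈𝒢} BR_g < v < s_max, where s_max is the maximum score in the common support, there exists a non-trivial threshold post-processor D̂_{(τ,R)} (not necessarily group blind) such that the composed hard classifier Ŷ = D̂_{(τ,R)}∘Ŝ satisfies PPV_{Ŷ,g} = v for every group g ∈ 𝒢; in particular Ŷ equalizes PPV across 𝒢. -/

import Mathlib

open Finset
open scoped Classical

namespace GroupFairness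

noncomputable section

variable {X 𝒢 Ω : Type*} [Fintype X] [Fintype Ω]

/-- The finset of members of group `g`. -/
def grp (Grp : X → 𝒢) (g : 𝒢) : Finset X :=
  Finset.univ.filter (fun x => Grp x = g)

/-- Expectation of `f x ω` over a uniformly random member `x` of group `g`,
together with internal randomness `ω` distributed according to the weights `w`. -/
def Ex (w : Ω → ℝ) (Grp : X → 𝒢) (g : 𝒢) (f : X → Ω → ℝ) : ℝ :=
  (∑ x ∈ grp Grp g, ∑ ω : Ω, w ω * f x ω) / ((grp Grp g).card : ℝ)

/-- Probability of the event `E x ω` for a uniformly random member of group `g`. -/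
def Pr (w : Ω → ℝ) (Grp : X → 𝒢) (g : 𝒢) (E : X → Ω → Prop) : ℝ :=
  Ex w Grp g (fun x ω => if E x ω then 1 else 0)

/-- Conditional probability of `E` given `F`. -/
def cPr (w : Ω → ℝ) (Grp : X → 𝒢) (g : 𝒢) (E F : X → Ω → Prop) : ℝ :=
  Pr w Grp g (fun x ω => E x ω ∧ F x ω) / Pr w Grp g F

/-- `w` is a probability weighting on the randomness space. -/
def ValidWeights (w : Ω → ℝ) : Prop :=
  (∀ ω, 0 ≤ w ω) ∧ ∑ ω : Ω, w ω = 1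

/-- The base rate of group `g`: the probability that a uniformly random member
of `g` has true type `1`. -/
def BaseRate (w : Ω → ℝ) (Grp : X → 𝒢) (Y : X → Bool) (g : 𝒢) : ℝ :=
  Pr w Grp g (fun x _ => Y x = true)

/-- All scores of the soft classifier lie in `[0,1]`. -/
def IsSoft (S : X → Ω → ℝ) : Prop :=
  ∀ x ω, 0 ≤ S x ω ∧ S x ω ≤ 1

/-- `S` is groupwise calibrated: for every group `g` and score `s` occurring with
positive probability, `Pr[Y = 1 ∣ S = s] = s`. -/
def Calibrated (w : Ω → ℝ) (Grp : X → 𝒢) (Y : X → Bool) (S : X → Ω → ℝ) : Prop :=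
  ∀ (g : 𝒢) (s : ℝ), 0 < Pr w Grp g (fun x ω => S x ω = s) →
    cPr w Grp g (fun x _ => Y x = true) (fun x ω => S x ω = s) = s

/-- The accuracy profile of `S` on group `g`: the pmf of the score `S(X_g)`. -/
def AP (w : Ω → ℝ) (Grp : X → 𝒢) (S : X → Ω → ℝ) (g : 𝒢) (s : ℝ) : ℝ :=
  Pr w Grp g (fun x ω => S x ω = s)

/-- The support of the accuracy profile of `S` on group `g`. -/
def APsupp (w : Ω → ℝ) (Grp : X → 𝒢) (S : X → Ω → ℝ) (g : 𝒢) : Set ℝ :=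
  {s | 0 < AP w Grp S g s}

/-- The accuracy profile is *nice*: all groups have the same support. -/
def NiceAP (w : Ω → ℝ) (Grp : X → 𝒢) (S : X → Ω → ℝ) : Prop :=
  ∀ g g' : 𝒢, APsupp w Grp S g = APsupp w Grp S g'

/-- A (randomized) hard post-processor is described by the probability `q s g` of
outputting `1` on score `s` and group `g`; it is valid if these are probabilities. -/
def ValidPP (q : ℝ → 𝒢 → ℝ) : Prop :=
  ∀ (s : ℝ) (g : 𝒢), 0 ≤ q s g ∧ q s g ≤ 1

/-- Probability that the composed hard classifier `D̂ ∘ Ŝ` outputs `1` on group `g`. -/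
def prPos (w : Ω → ℝ) (Grp : X → 𝒢) (S : X → Ω → ℝ) (q : ℝ → 𝒢 → ℝ) (g : 𝒢) : ℝ :=
  Ex w Grp g (fun x ω => q (S x ω) (Grp x))

/-- Probability that the composed hard classifier `D̂ ∘ Ŝ` outputs `0` on group `g`. -/
def prNeg (w : Ω → ℝ) (Grp : X → 𝒢) (S : X → Ω → ℝ) (q : ℝ → 𝒢 → ℝ) (g : 𝒢) : ℝ :=
  Ex w Grp g (fun x ω => 1 - q (S x ω) (Grp x))

/-- The composed hard classifier is non-trivial on `g`. -/
def NonTrivial (w : Ω → ℝ) (Grp : X → 𝒢) (S : X → Ω → ℝ) (q : ℝ → 𝒢 → ℝ) (g : 𝒢) : Prop :=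
  0 < prPos w Grp S q g ∧ 0 < prNeg w Grp S q g

/-- Positive predictive value `Pr[Y = 1 ∣ Ŷ = 1]` of the composed classifier on `g`. -/
def PPV (w : Ω → ℝ) (Grp : X → 𝒢) (Y : X → Bool) (S : X → Ω → ℝ)
    (q : ℝ → 𝒢 → ℝ) (g : 𝒢) : ℝ :=
  Ex w Grp g (fun x ω => (if Y x then 1 else 0) * q (S x ω) (Grp x)) / prPos w Grp S q g

/-- Negative predictive value `Pr[Y = 0 ∣ Ŷ = 0]` of the composed classifier on `g`. -/
def NPV (w : Ω → ℝ) (Grp : X → 𝒢) (Y : X → Bool) (S : X → Ω → ℝ)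
    (q : ℝ → 𝒢 → ℝ) (g : 𝒢) : ℝ :=
  Ex w Grp g (fun x ω => (if Y x then 0 else 1) * (1 - q (S x ω) (Grp x))) / prNeg w Grp S q g

/-- False positive rate `Pr[Ŷ = 1 ∣ Y = 0]` of the composed classifier on `g`. -/
def FPR (w : Ω → ℝ) (Grp : X → 𝒢) (Y : X → Bool) (S : X → Ω → ℝ)
    (q : ℝ → 𝒢 → ℝ) (g : 𝒢) : ℝ :=
  Ex w Grp g (fun x ω => (if Y x then 0 else 1) * q (S x ω) (Grp x)) /
    Pr w Grp g (fun x _ => Y x = false)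

/-- False negative rate `Pr[Ŷ = 0 ∣ Y = 1]` of the composed classifier on `g`. -/
def FNR (w : Ω → ℝ) (Grp : X → 𝒢) (Y : X → Bool) (S : X → Ω → ℝ)
    (q : ℝ → 𝒢 → ℝ) (g : 𝒢) : ℝ :=
  Ex w Grp g (fun x ω => (if Y x then 1 else 0) * (1 - q (S x ω) (Grp x))) /
    Pr w Grp g (fun x _ => Y x = true)

/-- The threshold post-processor with threshold `τ g` and on-threshold probability
`R g` for group `g`: it outputs `1` with probability `1` above the threshold, `0`
below it, and `1` with probability `R g` at the threshold. -/
def thresholdPP (τ R : 𝒢 → ℝ) : ℝ → 𝒢 → ℝ := fun s g =>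
  if τ g < s then 1 else if s = τ g then R g else 0

theorem Ex_congr (w : Ω → ℝ) (Grp : X → 𝒢) (g : 𝒢) {f f' : X → Ω → ℝ}
    (h : ∀ x, Grp x = g → ∀ ω, f x ω = f' x ω) : Ex w Grp g f = Ex w Grp g f' := by
  unfold Ex
  congr 1
  refine Finset.sum_congr rfl fun x hx => Finset.sum_congr rfl fun ω _ => ?_
  rw [h x (by simpa [grp] using hx)]

theorem Ex_mono {w : Ω → ℝ} (hw : ValidWeights w) (Grp : X → 𝒢) (g : 𝒢) {f f' : X → Ω → ℝ}
    (h : ∀ x ω, f x ω ≤ f' x ω) : Ex w Grp g f ≤ Ex w Grp g f' := by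
  unfold Ex
  gcongr with x _ ω _
  · exact hw.1 ω
  · exact h x ω

theorem Ex_nonneg {w : Ω → ℝ} (hw : ValidWeights w) (Grp : X → 𝒢) (g : 𝒢) {f : X → Ω → ℝ}
    (h : ∀ x ω, 0 ≤ f x ω) : 0 ≤ Ex w Grp g f :=
  div_nonneg (Finset.sum_nonneg fun x _ => Finset.sum_nonneg fun ω _ =>
    mul_nonneg (hw.1 ω) (h x ω)) (Nat.cast_nonneg _)

theorem Ex_finset_sum (w : Ω → ℝ) (Grp : X → 𝒢) (g : 𝒢) (I : Finset ℝ)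
    (f : ℝ → X → Ω → ℝ) (c : ℝ → ℝ) :
    Ex w Grp g (fun x ω => ∑ s ∈ I, f s x ω * c s) = ∑ s ∈ I, Ex w Grp g (f s) * c s := by
  simp only [Ex, div_mul_eq_mul_div, ← Finset.sum_div, Finset.sum_mul, Finset.mul_sum, mul_assoc]
  congr 1
  exact (Finset.sum_congr rfl fun x _ => Finset.sum_comm).trans Finset.sum_comm

/-- The finset of scores that occur with positive probability on group `g`. -/
def scores (w : Ω → ℝ) (Grp : X → 𝒢) (S : X → Ω → ℝ) (g : 𝒢) : Finset ℝ :=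
  (Finset.univ.image fun z : X × Ω => S z.1 z.2).filter fun s => 0 < AP w Grp S g s

theorem mem_scores {w : Ω → ℝ} {Grp : X → 𝒢} {S : X → Ω → ℝ} {g : 𝒢} {s : ℝ} :
    s ∈ scores w Grp S g ↔ 0 < AP w Grp S g s := by
  simp only [scores, Finset.mem_filter, and_iff_right_iff_imp]
  intro h
  by_contra hs
  have h0 : AP w Grp S g s = Ex w Grp g (fun _ _ => 0) := by
    refine Ex_congr w Grp g fun x _ ω => if_neg fun hx => hs ?_
    exact Finset.mem_image.2 ⟨(x, ω), Finset.mem_univ _, hx⟩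
  simp [Ex] at h0
  exact h.ne' h0

/-- If the mean of `a` on each level set of the score is `c s` times its probability, then
`E[a q(S)] = ∑ Pr[S = s] c(s) q(s)`. -/
theorem Ex_mul_comp_score {w : Ω → ℝ} (hw : ValidWeights w) (Grp : X → 𝒢) (S : X → Ω → ℝ)
    (g : 𝒢) (a : X → ℝ) (c q : ℝ → ℝ)
    (ha : ∀ s, Ex w Grp g (fun x ω => a x * if S x ω = s then 1 else 0) = AP w Grp S g s * c s) :
    Ex w Grp g (fun x ω => a x * q (S x ω)) =
      ∑ s ∈ scores w Grp S g, AP w Grp S g s * (c s * q s) := by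
  have h1 : Ex w Grp g (fun x ω => a x * q (S x ω)) =
      Ex w Grp g (fun x ω => ∑ s ∈ Finset.univ.image fun z : X × Ω => S z.1 z.2,
        (a x * if S x ω = s then 1 else 0) * q s) := by
    refine Ex_congr w Grp g fun x _ ω => ?_
    have hm : S x ω ∈ Finset.univ.image fun z : X × Ω => S z.1 z.2 :=
      Finset.mem_image.2 ⟨(x, ω), Finset.mem_univ _, rfl⟩
    rw [Finset.sum_eq_single_of_mem _ hm fun s _ hs => by simp [hs.symm]]
    simp
  rw [h1, Ex_finset_sum]
  simp only [ha, mul_assoc]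
  refine (Finset.sum_filter_of_ne fun s _ hs => ?_).symm
  refine lt_of_le_of_ne (Ex_nonneg hw Grp g fun x ω => ?_) (left_ne_zero_of_mul hs).symm
  split_ifs <;> norm_num

theorem Calibrated.Ex_type {w : Ω → ℝ} (hw : ValidWeights w) {Grp : X → 𝒢} {Y : X → Bool}
    {S : X → Ω → ℝ} (hcal : Calibrated w Grp Y S) (g : 𝒢) (s : ℝ) :
    Ex w Grp g (fun x ω => (if Y x then 1 else 0) * if S x ω = s then 1 else 0) =
      AP w Grp S g s * s := by
  have hnn : 0 ≤ AP w Grp S g s := Ex_nonneg hw Grp g fun x ω => by split_ifs <;> norm_num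
  rcases hnn.lt_or_eq with hp | hp
  · have h := hcal g s hp
    rw [cPr, div_eq_iff (show Pr w Grp g (fun x ω => S x ω = s) ≠ 0 from hp.ne')] at h
    rw [mul_comm]
    refine Eq.trans (Ex_congr w Grp g fun x _ ω => ?_) h
    by_cases h1 : Y x <;> by_cases h2 : S x ω = s <;> simp [h1, h2]
  · rw [← hp, zero_mul]
    refine le_antisymm ?_ (Ex_nonneg hw Grp g fun x ω => by split_ifs <;> norm_num)
    refine (Ex_mono hw Grp g (f' := fun x ω => if S x ω = s then 1 else 0) fun x ω => ?_).trans
      hp.ge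
    split_ifs <;> norm_num

/-- A finite positive measure on the line with negative mean excess over `v < m`, where `m` is
the top of the support, has a randomized upper tail with mean excess exactly zero. -/
theorem exists_threshold_sum_eq_zero (T : Finset ℝ) (p : ℝ → ℝ) (m v : ℝ)
    (hp : ∀ s ∈ T, 0 < p s) (hm : m ∈ T) (hmax : ∀ s ∈ T, s ≤ m) (hvm : v < m)
    (hneg : ∑ s ∈ T, p s * (s - v) < 0) :
    ∃ t r : ℝ, (0 ≤ r ∧ r ≤ 1) ∧ t < m ∧
      ∑ s ∈ T, p s * ((s - v) * if t < s then 1 else if s = t then r else 0) = 0 := by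
  set F : ℝ → ℝ := fun t => ∑ s ∈ T with t ≤ s, p s * (s - v) with hF
  have hne : (T.filter fun t => F t ≤ 0).Nonempty := by
    refine ⟨T.min' ⟨m, hm⟩, Finset.mem_filter.2 ⟨T.min'_mem _, ?_⟩⟩
    simp only [hF]
    rw [Finset.filter_true_of_mem fun s hs => T.min'_le s hs]
    exact hneg.le
  obtain ⟨ht, hFt⟩ := Finset.mem_filter.1 (Finset.max'_mem _ hne)
  have htmax : ∀ s ∈ T, F s ≤ 0 → s ≤ (T.filter fun t => F t ≤ 0).max' hne := fun s hs h =>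
    Finset.le_max' _ s (Finset.mem_filter.2 ⟨hs, h⟩)
  generalize (T.filter fun t => F t ≤ 0).max' hne = t at ht hFt htmax
  have htm : t < m := by
    refine lt_of_le_of_ne (hmax t ht) ?_
    rintro rfl
    have : F t = p t * (t - v) := by
      simp only [hF]
      rw [show (T.filter fun s => t ≤ s) = {t} from ?_, Finset.sum_singleton]
      ext s
      simp only [Finset.mem_filter, Finset.mem_singleton]
      exact ⟨fun h => le_antisymm (hmax s h.1) h.2, by rintro rfl; exact ⟨hm, le_rfl⟩⟩
    have := mul_pos (hp t ht) (sub_pos.2 hvm)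
    linarith
  set f : ℝ := ∑ s ∈ T with t < s, p s * (s - v) with hf
  have hfpos : 0 < f := by
    have hne' : (T.filter fun s => t < s).Nonempty := ⟨m, Finset.mem_filter.2 ⟨hm, htm⟩⟩
    obtain ⟨hu, htu⟩ := Finset.mem_filter.1 (Finset.min'_mem _ hne')
    have humin : ∀ s ∈ T, t < s → (T.filter fun s => t < s).min' hne' ≤ s := fun s hs h =>
      Finset.min'_le _ s (Finset.mem_filter.2 ⟨hs, h⟩)
    generalize (T.filter fun s => t < s).min' hne' = u at hu htu humin
    have hfu : f = F u := by
      simp only [hf, hF]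
      congr 1
      refine Finset.filter_congr fun s hs => ⟨humin s hs, htu.trans_le⟩
    rw [hfu]
    by_contra! h
    exact absurd (htmax u hu h) htu.not_ge
  have hFf : F t = p t * (t - v) + f := by
    simp only [hF, hf]
    rw [← Finset.sum_insert (f := fun s => p s * (s - v)) (by simp : t ∉ T.filter fun s => t < s)]
    refine Finset.sum_congr ?_ fun _ _ => rfl
    ext s
    simp only [Finset.mem_filter, Finset.mem_insert, le_iff_eq_or_lt]
    constructor
    · rintro ⟨hs, rfl | h⟩
      exacts [Or.inl rfl, Or.inr ⟨hs, h⟩]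
    · rintro (rfl | h)
      exacts [⟨ht, Or.inl rfl⟩, ⟨h.1, Or.inr h.2⟩]
  have hd : 0 < f - F t := by linarith
  refine ⟨t, f / (f - F t), ⟨by positivity, (div_le_one hd).2 (by linarith)⟩, htm, ?_⟩
  have hsplit : ∀ r : ℝ,
      ∑ s ∈ T, p s * ((s - v) * if t < s then 1 else if s = t then r else 0) =
        f + p t * (t - v) * r := by
    intro r
    rw [hf, Finset.sum_filter, ← Finset.sum_ite_eq' T t (fun s => p s * (s - v) * r) |>.trans
      (if_pos ht), ← Finset.sum_add_distrib]
    refine Finset.sum_congr rfl fun s _ => ?_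
    rcases lt_trichotomy t s with h | rfl | h
    · simp [h, h.ne']
    · simp; ring
    · simp [h.not_gt, h.ne]
  rw [hsplit, show p t * (t - v) = -(f - F t) by linarith]
  field_simp
  ring

/-- For a nice, groupwise calibrated soft classifier whose common
support has at least two points, and any target value `v` strictly between the maximum
base rate and the maximum score of the common support, there is a (not necessarily
group-blind) non-trivial threshold post-processor making the PPV of every group equal
to `v`; in particular PPV is equalized across the groups. -/
theorem exists_groupAware_threshold_equalizing_PPV [Fintype 𝒢]
    (w : Ω → ℝ) (Grp : X → 𝒢) (Y : X → Bool) (S : X → Ω → ℝ) (smax v : ℝ)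
    (hw : ValidWeights w) (hne : ∀ g : 𝒢, (grp Grp g).Nonempty)
    (hS : IsSoft S) (hcal : Calibrated w Grp Y S) (hnice : NiceAP w Grp S)
    (hsupp2 : ∀ g : 𝒢, ∃ s₁ s₂ : ℝ, s₁ ≠ s₂ ∧
      s₁ ∈ APsupp w Grp S g ∧ s₂ ∈ APsupp w Grp S g)
    (hsmax : ∀ g : 𝒢, smax ∈ APsupp w Grp S g ∧ ∀ s ∈ APsupp w Grp S g, s ≤ smax)
    (hv₁ : ∀ g : 𝒢, BaseRate w Grp Y g < v) (hv₂ : v < smax) :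
    ∃ τ R : 𝒢 → ℝ, (∀ g : 𝒢, 0 ≤ R g ∧ R g ≤ 1) ∧
      (∀ g : 𝒢, NonTrivial w Grp S (thresholdPP τ R) g) ∧
      ∀ g : 𝒢, PPV w Grp Y S (thresholdPP τ R) g = v := by
  have hE1 (g : 𝒢) (q : ℝ → ℝ) : Ex w Grp g (fun x ω => q (S x ω)) =
      ∑ s ∈ scores w Grp S g, AP w Grp S g s * q s := by
    simpa using Ex_mul_comp_score hw Grp S g (fun _ => 1) (fun _ => 1) q
      (fun s => by simp [AP, Pr])
  have hEY (g : 𝒢) (q : ℝ → ℝ) := Ex_mul_comp_score hw Grp S g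
    (fun x => if Y x then 1 else 0) (fun s => s) q (hcal.Ex_type hw g)
  have hone (g : 𝒢) : ∑ s ∈ scores w Grp S g, AP w Grp S g s = 1 := by
    have h := hE1 g fun _ => 1
    simp only [mul_one] at h
    have hc : ((grp Grp g).card : ℝ) ≠ 0 := by
      exact_mod_cast (hne g).card_ne_zero
    rw [← h]
    simp [Ex, hw.2, hc]
  have hneg (g : 𝒢) : ∑ s ∈ scores w Grp S g, AP w Grp S g s * (s - v) < 0 := by
    have h := hEY g fun _ => 1
    have hb : BaseRate w Grp Y g = ∑ s ∈ scores w Grp S g, AP w Grp S g s * s := by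
      simp only [mul_one] at h
      rw [← h]
      exact Ex_congr w Grp g fun x _ ω => by congr
    simp only [mul_sub, Finset.sum_sub_distrib, ← Finset.sum_mul, hone, one_mul]
    linarith [hv₁ g]
  choose τ R hR hτ h0 using fun g => exists_threshold_sum_eq_zero (scores w Grp S g)
    (AP w Grp S g) smax v (fun s => mem_scores.1) (mem_scores.2 (hsmax g).1)
    (fun s hs => (hsmax g).2 s (mem_scores.1 hs)) hv₂ (hneg g)
  have hq (s : ℝ) (g : 𝒢) : 0 ≤ thresholdPP τ R s g ∧ thresholdPP τ R s g ≤ 1 := by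
    unfold thresholdPP
    split_ifs
    exacts [⟨zero_le_one, le_rfl⟩, hR g, ⟨le_rfl, zero_le_one⟩]
  have hpos (g : 𝒢) : prPos w Grp S (thresholdPP τ R) g =
      ∑ s ∈ scores w Grp S g, AP w Grp S g s * thresholdPP τ R s g := by
    rw [← hE1 g fun s => thresholdPP τ R s g]
    exact Ex_congr w Grp g fun x hx ω => by rw [hx]
  have hprneg (g : 𝒢) : prNeg w Grp S (thresholdPP τ R) g =
      ∑ s ∈ scores w Grp S g, AP w Grp S g s * (1 - thresholdPP τ R s g) := by
    rw [← hE1 g fun s => 1 - thresholdPP τ R s g]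
    exact Ex_congr w Grp g fun x hx ω => by rw [hx]
  have hnum (g : 𝒢) : Ex w Grp g
      (fun x ω => (if Y x then 1 else 0) * thresholdPP τ R (S x ω) (Grp x)) =
      v * prPos w Grp S (thresholdPP τ R) g := by
    rw [Ex_congr w Grp g (f' := fun x ω => (if Y x then 1 else 0) * thresholdPP τ R (S x ω) g)
      fun x hx ω => by rw [hx], hEY g fun s => thresholdPP τ R s g, hpos, ← sub_eq_zero,
      Finset.mul_sum, ← Finset.sum_sub_distrib, ← h0 g]
    exact Finset.sum_congr rfl fun s _ => by unfold thresholdPP; ring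
  have hpos' (g : 𝒢) : 0 < prPos w Grp S (thresholdPP τ R) g := by
    rw [hpos]
    refine Finset.sum_pos' (fun s hs => mul_nonneg (mem_scores.1 hs).le (hq s g).1)
      ⟨smax, mem_scores.2 (hsmax g).1, ?_⟩
    simpa [thresholdPP, hτ g] using show 0 < AP w Grp S g smax from (hsmax g).1
  refine ⟨τ, R, hR, fun g => ⟨hpos' g, ?_⟩, fun g => ?_⟩
  · rw [hprneg]
    have hnn : ∀ s ∈ scores w Grp S g, 0 ≤ AP w Grp S g s * (1 - thresholdPP τ R s g) :=
      fun s hs => mul_nonneg (mem_scores.1 hs).le (sub_nonneg.2 (hq s g).2)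
    refine lt_of_le_of_ne (Finset.sum_nonneg hnn) fun h => ?_
    have hall := (Finset.sum_eq_zero_iff_of_nonneg hnn).1 h.symm
    refine (hneg g).ne ((Finset.sum_congr rfl fun s hs => ?_).trans (h0 g))
    have h1 : 1 - thresholdPP τ R s g = 0 :=
      (mul_eq_zero.1 (hall s hs)).resolve_left (mem_scores.1 hs).ne'
    change _ = AP w Grp S g s * ((s - v) * thresholdPP τ R s g)
    rw [← sub_eq_zero.1 h1, mul_one]
  · rw [PPV, hnum, mul_div_cancel_right₀ _ (hpos' g).ne']

end

end GroupFairness
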